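/- Suppose v_{t+1} < M_t for every t ∈ ℕ ∪ {0}. Then: (1) the sequence o₀ < o₁ < o₂ < ⋯ is strictly increasing; (2) s ↦ v_{o_s} is strictly decreasing; (3) for every s and every i with o_s ≤ i ≤ o_{s+1}, v_i ≤ v_{o_s}; consequently v_k ≤ v_0 for all k. -/

import Mathlib

open scoped Classical

noncomputable section

abbrev Evec (n : ℕ) : Type := EuclideanSpace ℝ (Fin n)

/-- `ell θ t` is the index `ℓ_t` of the `t`-th distinct outer iterate
(`none` encodes `∞`): `ℓ₀ = 0` and `ℓ_{t+1} = min {k > ℓ_t : θ k ≠ θ (ℓ_t)}`. -/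
noncomputable def ell {X : Type*} (θ : ℕ → X) : ℕ → Option ℕ
  | 0 => some 0
  | t + 1 =>
    (ell θ t).bind (fun m =>
      if h : ∃ k, m < k ∧ θ k ≠ θ m then some (Nat.find h) else none)

/-- The value of `ℓ_t` (junk value `0` if `ℓ_t = ∞`). -/
noncomputable def ellv {X : Type*} (θ : ℕ → X) (t : ℕ) : ℕ := (ell θ t).getD 0

/-- `L(k) = max {t : ℓ_t ≤ k}`. -/
noncomputable def Lfun {X : Type*} (θ : ℕ → X) (k : ℕ) : ℕ :=
  sSup {t | ∃ m, ell θ t = some m ∧ m ≤ k}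

/-- The nonmonotone threshold
`τ_obj^k = max {F (θ (ℓ_s)) : max{L(k) - w + 1, 0} ≤ s ≤ L(k)}`. -/
noncomputable def tauObj {X : Type*} (F : X → ℝ) (θ : ℕ → X) (w k : ℕ) : ℝ :=
  sSup ((fun s => F (θ (ellv θ s))) '' Set.Icc (Lfun θ k + 1 - w) (Lfun θ k))

/-- `O(k) = max {s ≤ L(k) : F (θ (ℓ_s)) = τ_obj^k}`. -/
noncomputable def Ofun {X : Type*} (F : X → ℝ) (θ : ℕ → X) (w k : ℕ) : ℕ :=
  sSup {s | s ≤ Lfun θ k ∧ F (θ (ellv θ s)) = tauObj F θ w k}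

/-- `o₀ = 0` and `o_s = O(ℓ_{o_{s-1} + w})`, with `none` encoding `∞`. -/
noncomputable def oseq {X : Type*} (F : X → ℝ) (θ : ℕ → X) (w : ℕ) : ℕ → Option ℕ
  | 0 => some 0
  | s + 1 =>
    (oseq F θ w s).bind (fun p => (ell θ (p + w)).map (fun m => Ofun F θ w m))

/-- The value of `o_s` (junk value `0` if `o_s = ∞`). -/
noncomputable def ov {X : Type*} (F : X → ℝ) (θ : ℕ → X) (w s : ℕ) : ℕ := (oseq F θ w s).getD 0

/-- `g₀ = 0` and `g_u = min {o_s : o_s ≥ g_{u-1} + w}`, with `none` encoding `∞`. -/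
noncomputable def gseq {X : Type*} (F : X → ℝ) (θ : ℕ → X) (w : ℕ) : ℕ → Option ℕ
  | 0 => some 0
  | u + 1 =>
    (gseq F θ w u).bind (fun p =>
      if h : ∃ m, (∃ s, oseq F θ w s = some m) ∧ p + w ≤ m then some (Nat.find h) else none)

/-- The value of `g_u` (junk value `0` if `g_u = ∞`). -/
noncomputable def gv {X : Type*} (F : X → ℝ) (θ : ℕ → X) (w u : ℕ) : ℕ := (gseq F θ w u).getD 0

/-- `C'_u = ⋃_{k = ℓ_{g_{u-1}}}^{ℓ_{g_u} - 1} C_k`. -/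
noncomputable def Cprime {X : Type*} (F : X → ℝ) (θ : ℕ → X) (w : ℕ) (C : ℕ → Set X) (u : ℕ) :
    Set X :=
  ⋃ k ∈ Set.Ico (ellv θ (gv F θ w (u - 1))) (ellv θ (gv F θ w u)), C k

/-- Windowed maximum `M_t = max {v_s : max{t - w + 1, 0} ≤ s ≤ t}`. -/
noncomputable def Mwin (v : ℕ → ℝ) (w t : ℕ) : ℝ :=
  sSup (v '' Set.Icc (t + 1 - w) t)

/-- Last-argmax index `O(t) = max {s ≤ t : v_s = M_t}`. -/
noncomputable def Owin (v : ℕ → ℝ) (w t : ℕ) : ℕ :=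
  sSup {s | s ≤ t ∧ v s = Mwin v w t}

/-- `o₀ = 0` and `o_{s+1} = O(o_s + w)`. -/
noncomputable def owin (v : ℕ → ℝ) (w : ℕ) : ℕ → ℕ
  | 0 => 0
  | s + 1 => Owin v w (owin v w s + w)

theorem le_Mwin (v : ℕ → ℝ) {w t i : ℕ} (h₁ : t + 1 - w ≤ i) (h₂ : i ≤ t) :
    v i ≤ Mwin v w t :=
  le_csSup ((Set.finite_Icc _ _).image v).bddAbove ⟨i, ⟨h₁, h₂⟩, rfl⟩

theorem exists_eq_Mwin (v : ℕ → ℝ) {w : ℕ} (hw : 1 ≤ w) (t : ℕ) :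
    ∃ j, t + 1 - w ≤ j ∧ j ≤ t ∧ v j = Mwin v w t := by
  have hne : (v '' Set.Icc (t + 1 - w) t).Nonempty :=
    (Set.nonempty_Icc.2 (by omega)).image v
  obtain ⟨j, hj, hv⟩ := hne.csSup_mem ((Set.finite_Icc _ _).image v)
  exact ⟨j, hj.1, hj.2, hv⟩

theorem bddAbove_argmax_Mwin (v : ℕ → ℝ) (w t : ℕ) :
    BddAbove {s | s ≤ t ∧ v s = Mwin v w t} :=
  ⟨t, fun _ hs => hs.1⟩

theorem Owin_spec (v : ℕ → ℝ) {w : ℕ} (hw : 1 ≤ w) (t : ℕ) :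
    t + 1 - w ≤ Owin v w t ∧ Owin v w t ≤ t ∧ v (Owin v w t) = Mwin v w t := by
  obtain ⟨j, hj₁, hj₂, hv⟩ := exists_eq_Mwin v hw t
  have hmem : Owin v w t ∈ {s | s ≤ t ∧ v s = Mwin v w t} :=
    Nat.sSup_mem ⟨j, hj₂, hv⟩ (bddAbove_argmax_Mwin v w t)
  exact ⟨hj₁.trans (le_csSup (bddAbove_argmax_Mwin v w t) ⟨hj₂, hv⟩), hmem⟩

theorem lt_of_Owin_lt (v : ℕ → ℝ) {w : ℕ} (hw : 1 ≤ w) {t i : ℕ}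
    (h₁ : Owin v w t < i) (h₂ : i ≤ t) : v i < v (Owin v w t) := by
  obtain ⟨hlow, -, hv⟩ := Owin_spec v hw t
  rw [hv]
  refine lt_of_le_of_ne (le_Mwin v (by omega) h₂) fun h => h₁.not_ge ?_
  exact le_csSup (bddAbove_argmax_Mwin v w t) ⟨h₂, h⟩

/-- Under the decrease condition, the last argmax over a window strictly dominates
every later value. -/
theorem lt_Owin_of_Mwin_decrease (v : ℕ → ℝ) {w : ℕ} (hw : 1 ≤ w)
    (hdec : ∀ t, v (t + 1) < Mwin v w t) (t : ℕ) {i : ℕ} (hi : Owin v w t < i) :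
    v i < v (Owin v w t) := by
  induction i using Nat.strong_induction_on with
  | _ i ih =>
    by_cases hit : i ≤ t
    · exact lt_of_Owin_lt v hw hi hit
    obtain ⟨n, rfl⟩ : ∃ n, i = n + 1 := ⟨i - 1, by omega⟩
    obtain ⟨j, hj₁, hj₂, hv⟩ := exists_eq_Mwin v hw n
    refine (hdec n).trans_le (hv ▸ ?_)
    rcases lt_or_ge (Owin v w t) j with hj | hj
    · exact (ih j (by omega) hj).le
    · obtain ⟨-, hle, hO⟩ := Owin_spec v hw t
      exact hO ▸ le_Mwin v (by omega) (hj.trans hle)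

theorem lt_owin_of_Mwin_decrease (v : ℕ → ℝ) {w : ℕ} (hw : 1 ≤ w)
    (hdec : ∀ t, v (t + 1) < Mwin v w t) (s : ℕ) {i : ℕ} (hi : owin v w s < i) :
    v i < v (owin v w s) := by
  cases s with
  | zero =>
    have h0 : Owin v w 0 = 0 := Nat.le_zero.1 (Owin_spec v hw 0).2.1
    have h := lt_Owin_of_Mwin_decrease v hw hdec 0 (i := i)
    rw [h0] at h
    exact h hi
  | succ s => exact lt_Owin_of_Mwin_decrease v hw hdec _ hi

theorem stmt8 (v : ℕ → ℝ) (w : ℕ) (hw : 1 ≤ w)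
    (hdec : ∀ t, v (t + 1) < Mwin v w t) :
    StrictMono (owin v w) ∧
    StrictAnti (fun s => v (owin v w s)) ∧
    (∀ s i, owin v w s ≤ i → i ≤ owin v w (s + 1) → v i ≤ v (owin v w s)) ∧
    (∀ k, v k ≤ v 0) := by
  have hmono : StrictMono (owin v w) := strictMono_nat_of_lt_succ fun s => by
    have h : owin v w s + w + 1 - w ≤ owin v w (s + 1) :=
      (Owin_spec v hw (owin v w s + w)).1
    omega
  have hle : ∀ s i, owin v w s ≤ i → v i ≤ v (owin v w s) := fun s i hi =>
    hi.eq_or_lt.elim (fun h => h ▸ le_rfl)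
      fun h => (lt_owin_of_Mwin_decrease v hw hdec s h).le
  exact ⟨hmono, fun a b hab => lt_owin_of_Mwin_decrease v hw hdec a (hmono hab),
    fun s i hi _ => hle s i hi, fun k => hle 0 k (Nat.zero_le k)⟩

end
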